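/- arXiv:0810.4609 — 2 statements merged into one kernel-verified Lean document; each statement's English description precedes it below -/
import Mathlib

section
/- Let (P_t)_{t≥0} be a Feller, stochastically continuous Markov transition semigroup on a Polish metric space 𝒳 with the e-property, and suppose there exists z ∈ 𝒳 such that liminf_{T→∞} Q^T(x, B(z,δ)) > 0 for every δ > 0 and every x ∈ 𝒳. Fix ε > 0, a sequence (η_n) of positive numbers decreasing monotonically to 0, points x₁, x₂ ∈ 𝒯, and a bounded Lipschitz function ψ. Define Δ ⊆ ℝ by: α ∈ Δ iff α > 0 and there exist a positive integer N, times (T_{α,n})_{n≥N} and probability measures (μ^n_{α,i}), (ν^n_{α,i}) (i = 1,2, n ≥ N) such that for all n ≥ N: T_{α,n} ≥ n; ‖Q^{T_{α,n}}(x_i,·) − μ^n_{α,i}‖_TV < η_n for i = 1,2; μ^n_{α,i}(B) ≥ α ν^n_{α,i}(B) for every Borel set B and i = 1,2; and limsup_{T→∞} | ∫ ψ dQ^T ν^n_{α,1} − ∫ ψ dQ^T ν^n_{α,2} | < ε. Then Δ is nonempty and sup Δ = 1. -/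
open MeasureTheory Filter Topology Metric Set

noncomputable section

/-- A Markov transition semigroup on a measurable space `X`: a jointly measurable family
of Markov probability kernels `P t x` with `P 0 x = δ_x` and the Chapman–Kolmogorov
semigroup property for nonnegative times. -/
structure MarkovSemigroup (X : Type*) [MeasurableSpace X] where
  P : ℝ → X → MeasureTheory.Measure X
  prob : ∀ t x, MeasureTheory.IsProbabilityMeasure (P t x)
  meas : Measurable fun p : ℝ × X => P p.1 p.2
  init : ∀ x : X, P 0 x = MeasureTheory.Measure.dirac x
  semigroup : ∀ t s : ℝ, 0 ≤ t → 0 ≤ s → ∀ x : X,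
    P (t + s) x = (P t x).bind (P s)

namespace MarkovSemigroup

variable {X : Type*} [MeasurableSpace X]

/-- Action `P_t f(x) = ∫ f(y) P_t(x,dy)` on functions. -/
def act (M : MarkovSemigroup X) (t : ℝ) (f : X → ℝ) (x : X) : ℝ :=
  ∫ y, f y ∂(M.P t x)

/-- Dual action `P_t^* μ` on measures. -/
def dual (M : MarkovSemigroup X) (t : ℝ) (μ : MeasureTheory.Measure X) :
    MeasureTheory.Measure X :=
  μ.bind (M.P t)

/-- The time average `Q^T μ = (1/T) ∫_0^T P_s^* μ ds` (with the convention
`Q^T μ = μ` for `T ≤ 0`). -/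
def QM (M : MarkovSemigroup X) (T : ℝ) (μ : MeasureTheory.Measure X) :
    MeasureTheory.Measure X :=
  if T ≤ 0 then μ
  else ((ENNReal.ofReal (1 / T)) • (volume.restrict (Set.Ioc (0 : ℝ) T))).bind
    fun s => M.dual s μ

/-- `Q^T(x,·) := Q^T δ_x`. -/
def Q (M : MarkovSemigroup X) (T : ℝ) (x : X) : MeasureTheory.Measure X :=
  M.QM T (MeasureTheory.Measure.dirac x)

/-- Iterated averages: for `ts = [t_k, …, t_1]`, `QMs ts μ = Q^{t_k}(⋯(Q^{t_1} μ)⋯)`. -/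
def QMs (M : MarkovSemigroup X) (ts : List ℝ) (μ : MeasureTheory.Measure X) :
    MeasureTheory.Measure X :=
  ts.foldr (fun t ν => M.QM t ν) μ

/-- A measure is invariant if `P_t^* μ = μ` for all `t ≥ 0`. -/
def Invariant (M : MarkovSemigroup X) (μ : MeasureTheory.Measure X) : Prop :=
  ∀ t : ℝ, 0 ≤ t → M.dual t μ = μ

section TopologicalDefs

variable [TopologicalSpace X]

/-- Bounded continuous real functions. -/
def IsBddContinuous (f : X → ℝ) : Prop :=
  Continuous f ∧ ∃ C : ℝ, ∀ x, |f x| ≤ C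

/-- The Feller property: `P_t` maps bounded continuous functions to continuous ones. -/
def Feller (M : MarkovSemigroup X) : Prop :=
  ∀ t : ℝ, 0 ≤ t → ∀ f : X → ℝ, MarkovSemigroup.IsBddContinuous f →
    Continuous (M.act t f)

/-- Stochastic continuity: `P_t f(x) → f(x)` as `t → 0+`. -/
def StochasticallyContinuous (M : MarkovSemigroup X) : Prop :=
  ∀ f : X → ℝ, MarkovSemigroup.IsBddContinuous f → ∀ x : X,
    Filter.Tendsto (fun t : ℝ => M.act t f x) (nhdsWithin 0 (Set.Ioi 0)) (nhds (f x))

/-- Weak convergence of `Q^T ν` to `μ` as `T → ∞`. -/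
def QTendsto (M : MarkovSemigroup X) (ν μ : MeasureTheory.Measure X) : Prop :=
  ∀ f : X → ℝ, MarkovSemigroup.IsBddContinuous f →
    Filter.Tendsto (fun T : ℝ => ∫ x, f x ∂(M.QM T ν)) Filter.atTop
      (nhds (∫ x, f x ∂μ))

/-- Weak-* mean ergodicity with limit `μstar`. -/
def WeakStarMeanErgodic (M : MarkovSemigroup X) (μstar : MeasureTheory.Measure X) : Prop :=
  ∀ ν : MeasureTheory.Measure X, MeasureTheory.IsProbabilityMeasure ν → M.QTendsto ν μstar

/-- Tightness of the family `(Q^T(x,·))_{T>0}`. -/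
def TightAt (M : MarkovSemigroup X) (x : X) : Prop :=
  ∀ ε : ℝ, 0 < ε → ∃ K : Set X, IsCompact K ∧
    ∀ T : ℝ, 0 < T → 1 - ε ≤ ((M.Q T x) K).toReal

end TopologicalDefs

end MarkovSemigroup

/-- Topological support of a measure: points all of whose open neighborhoods
have positive mass. -/
def msupport {X : Type*} [MeasurableSpace X] [TopologicalSpace X]
    (μ : MeasureTheory.Measure X) : Set X :=
  {x : X | ∀ U : Set X, IsOpen U → x ∈ U → 0 < μ U}

/-- Total variation distance between two (finite) measures, as the supremum over
Borel sets of the discrepancy of masses. -/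
def tvDist {X : Type*} [MeasurableSpace X] (μ ν : MeasureTheory.Measure X) : ℝ :=
  ⨆ B : {B : Set X // MeasurableSet B}, |(μ B.1).toReal - (ν B.1).toReal|

section MetricDefs

variable {X : Type*} [MeasurableSpace X] [PseudoMetricSpace X]

/-- Bounded Lipschitz real functions. -/
def IsBddLipschitz (ψ : X → ℝ) : Prop :=
  (∃ K : NNReal, LipschitzWith K ψ) ∧ ∃ C : ℝ, ∀ x, |ψ x| ≤ C

/-- The e-property: equicontinuity of `(P_t ψ)_{t ≥ 0}` at every point, for every
bounded Lipschitz `ψ`. -/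
def MarkovSemigroup.EProperty (M : MarkovSemigroup X) : Prop :=
  ∀ ψ : X → ℝ, IsBddLipschitz ψ → ∀ x : X, ∀ ε : ℝ, 0 < ε →
    ∃ δ : ℝ, 0 < δ ∧ ∀ z : X, dist z x < δ → ∀ t : ℝ, 0 ≤ t →
      |M.act t ψ z - M.act t ψ x| < ε

end MetricDefs

theorem abs_integral_le_of_abs_le {Ω : Type*} [MeasurableSpace Ω] (μ : Measure Ω)
    [IsProbabilityMeasure μ] {g : Ω → ℝ} {C : ℝ} (hC : ∀ᵐ x ∂μ, |g x| ≤ C) :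
    |∫ x, g x ∂μ| ≤ C := by
  simpa using norm_integral_le_of_norm_le_const (μ := μ) (f := g) hC

open ProbabilityTheory in
/-- Integration of a bounded measurable function against a mixture of probability measures. -/
theorem integral_bind_of_bounded {α β : Type*} [MeasurableSpace α] [MeasurableSpace β]
    {m : Measure α} [IsProbabilityMeasure m] {κ : α → Measure β} (hκ : Measurable κ)
    (hκp : ∀ a, IsProbabilityMeasure (κ a)) {g : β → ℝ} (hg : Measurable g) {C : ℝ}
    (hC : ∀ x, |g x| ≤ C) :
    IsProbabilityMeasure (m.bind κ) ∧ ∫ x, g x ∂(m.bind κ) = ∫ a, ∫ x, g x ∂(κ a) ∂m := by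
  let k : Kernel α β := ⟨κ, hκ⟩
  have : IsMarkovKernel k := ⟨hκp⟩
  have hb : m.bind κ = (m ⊗ₘ k).map Prod.snd := (Measure.snd_compProd m k).symm
  have hp : IsProbabilityMeasure ((m ⊗ₘ k).map Prod.snd) :=
    Measure.isProbabilityMeasure_map measurable_snd.aemeasurable
  rw [hb]
  refine ⟨hp, ?_⟩
  rw [integral_map measurable_snd.aemeasurable hg.aestronglyMeasurable,
    Measure.integral_compProd]
  · rfl
  · exact Integrable.of_bound (hg.comp measurable_snd).aestronglyMeasurable C
      (Eventually.of_forall fun p => hC p.2)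

/-- A bounded pointwise equicontinuous sequence of real functions on a separable space has
a pointwise convergent subsequence with continuous limit. -/
theorem Equicontinuous.exists_subseq_tendsto {X : Type*} [TopologicalSpace X]
    [TopologicalSpace.SeparableSpace X] {F : ℕ → X → ℝ} (hF : Equicontinuous F) {C : ℝ}
    (hC : ∀ n x, |F n x| ≤ C) :
    ∃ f : X → ℝ, Continuous f ∧ ∃ φ : ℕ → ℕ, StrictMono φ ∧
      ∀ x, Tendsto (fun n => F (φ n) x) atTop (𝓝 (f x)) := by
  have hK : IsCompact (Set.univ.pi fun _ : X => Set.Icc (-C) C) :=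
    isCompact_univ_pi fun _ => isCompact_Icc
  obtain ⟨f, -, hf⟩ := hK.exists_mapClusterPt (f := atTop) (u := F)
    (by simpa using ⟨0, fun n _ =>
      ⟨fun x => (abs_le.1 (hC n x)).1, fun x => (abs_le.1 (hC n x)).2⟩⟩)
  obtain ⟨U, hU, hUf⟩ := mapClusterPt_iff_ultrafilter.1 hf
  have hfc : Continuous f := hUf.continuous_of_equicontinuous hF
  obtain ⟨D, hDc, hD⟩ := TopologicalSpace.exists_countable_dense X
  have : Countable D := hDc.to_subtype
  have hr : Continuous (fun (g : X → ℝ) (d : D) => g d) := by fun_prop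
  have hcl : MapClusterPt (fun d : D => f d) atTop (fun n (d : D) => F n d) :=
    hf.continuousAt_comp (f := fun (g : X → ℝ) (d : D) => g d) hr.continuousAt
  obtain ⟨φ, hφ, hlim⟩ := hcl.tendsto_subseq
  refine ⟨f, hfc, φ, hφ, fun x => ?_⟩
  have hE : Equicontinuous (fun n => F (φ n)) := hF.comp φ
  have hclosed := hE.isClosed_setOfPred_tendsto (l := atTop) hfc
  have hsub : D ⊆ {x | Tendsto (fun n => F (φ n) x) atTop (𝓝 (f x))} := fun d hd =>
    (tendsto_pi_nhds.1 hlim) ⟨d, hd⟩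
  exact (hclosed.closure_subset_iff.2 hsub) (hD x)

/-- The uniform probability measure on `(0, T]`. -/
def uniformTime (T : ℝ) : Measure ℝ :=
  ENNReal.ofReal (1 / T) • volume.restrict (Set.Ioc (0 : ℝ) T)

theorem isProbabilityMeasure_uniformTime {T : ℝ} (hT : 0 < T) :
    IsProbabilityMeasure (uniformTime T) := by
  constructor
  simp only [uniformTime, Measure.smul_apply, Measure.restrict_apply_univ, Real.volume_Ioc,
    sub_zero, smul_eq_mul]
  rw [← ENNReal.ofReal_mul (by positivity), one_div_mul_cancel hT.ne', ENNReal.ofReal_one]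

theorem ae_uniformTime_pos (T : ℝ) : ∀ᵐ s ∂(uniformTime T), 0 < s :=
  Measure.ae_smul_measure ((ae_restrict_mem measurableSet_Ioc).mono fun _ hs => hs.1) _

theorem integral_uniformTime {T : ℝ} (hT : 0 < T) (h : ℝ → ℝ) :
    ∫ s, h s ∂(uniformTime T) = (1 / T) * ∫ s in (0 : ℝ)..T, h s := by
  rw [uniformTime, integral_smul_measure, intervalIntegral.integral_of_le hT.le,
    ENNReal.toReal_ofReal (by positivity), smul_eq_mul]

/-- Time averages of a bounded function are asymptotically shift invariant. -/
theorem abs_integral_uniformTime_shift_sub_le {T t C : ℝ} (hT : 0 < T) (ht : 0 ≤ t) {h : ℝ → ℝ}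
    (hh : Measurable h) (hC : ∀ s, |h s| ≤ C) :
    |∫ s, h (t + s) ∂(uniformTime T) - ∫ s, h s ∂(uniformTime T)| ≤ 2 * t * C / T := by
  have hi : ∀ a b : ℝ, IntervalIntegrable h volume a b := fun a b =>
    intervalIntegrable_iff.2 <| IntegrableOn.of_bound (by simp) hh.aestronglyMeasurable C
      (Eventually.of_forall hC)
  have h1 : ∀ a b : ℝ, |∫ s in a..b, h s| ≤ C * |b - a| := fun a b => by
    simpa only [Real.norm_eq_abs] using
      intervalIntegral.norm_integral_le_of_norm_le_const (f := h) (a := a) (b := b)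
        fun s _ => hC s
  rw [integral_uniformTime hT, integral_uniformTime hT, ← mul_sub,
    intervalIntegral.integral_comp_add_left, add_zero,
    intervalIntegral.integral_interval_sub_interval_comm (hi _ _) (hi _ _) (hi _ _),
    abs_mul, abs_of_pos (by positivity : 0 < 1 / T)]
  have h2 := h1 t 0
  have h3 := h1 (t + T) T
  rw [zero_sub, abs_neg, abs_of_nonneg ht] at h2
  rw [show T - (t + T) = -t by ring, abs_neg, abs_of_nonneg ht] at h3
  have h4 : |(∫ s in t..0, h s) - ∫ s in (t + T)..T, h s| ≤ 2 * t * C := by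
    refine (abs_sub _ _).trans ?_
    linarith
  calc 1 / T * |(∫ s in t..0, h s) - ∫ s in (t + T)..T, h s| ≤ 1 / T * (2 * t * C) := by gcongr
    _ = _ := by ring

namespace MarkovSemigroup

variable {X : Type*} [MeasurableSpace X] (M : MarkovSemigroup X)

theorem measurable_P (t : ℝ) : Measurable (M.P t) :=
  M.meas.comp measurable_prodMk_left

theorem measurable_uncurry_act {g : X → ℝ} (hg : Measurable g) :
    Measurable fun p : ℝ × X => M.act p.1 g p.2 := by
  let k : ProbabilityTheory.Kernel (ℝ × X) X := ⟨fun p => M.P p.1 p.2, M.meas⟩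
  have : ProbabilityTheory.IsMarkovKernel k := ⟨fun p => M.prob _ _⟩
  exact (hg.stronglyMeasurable.integral_kernel (κ := k)).measurable

theorem measurable_act {g : X → ℝ} (hg : Measurable g) (t : ℝ) : Measurable (M.act t g) :=
  (M.measurable_uncurry_act hg).comp measurable_prodMk_left

theorem measurable_act_time {g : X → ℝ} (hg : Measurable g) (x : X) :
    Measurable fun t => M.act t g x :=
  (M.measurable_uncurry_act hg).comp measurable_prodMk_right

theorem integrable_P {g : X → ℝ} (hg : Measurable g) {C : ℝ} (hC : ∀ x, |g x| ≤ C) (t : ℝ)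
    (x : X) : Integrable g (M.P t x) :=
  have := M.prob t x
  Integrable.of_bound hg.aestronglyMeasurable C (Eventually.of_forall hC)

theorem abs_act_le {g : X → ℝ} {C : ℝ} (hC : ∀ x, |g x| ≤ C) (t : ℝ) (x : X) :
    |M.act t g x| ≤ C :=
  have := M.prob t x
  abs_integral_le_of_abs_le _ (Eventually.of_forall hC)

theorem act_act {g : X → ℝ} (hg : Measurable g) {C : ℝ} (hC : ∀ x, |g x| ≤ C) {t s : ℝ}
    (ht : 0 ≤ t) (hs : 0 ≤ s) (x : X) : M.act t (M.act s g) x = M.act (t + s) g x := by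
  have := M.prob t x
  rw [act, act, M.semigroup t s ht hs x,
    (integral_bind_of_bounded (M.measurable_P s) (M.prob s) hg hC).2]
  rfl

theorem measurable_dual (μ : Measure X) [IsProbabilityMeasure μ] :
    Measurable fun s => M.dual s μ := by
  refine Measure.measurable_of_measurable_coe _ fun B hB => ?_
  simp_rw [dual, Measure.bind_apply hB (M.measurable_P _).aemeasurable]
  exact (((Measure.measurable_coe hB).comp M.meas)).lintegral_prod_right'

theorem isProbabilityMeasure_dual (μ : Measure X) [IsProbabilityMeasure μ] (s : ℝ) :
    IsProbabilityMeasure (M.dual s μ) :=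
  (integral_bind_of_bounded (M.measurable_P s) (M.prob s) (g := 0) measurable_zero (C := 0)
    (by simp)).1

theorem QM_of_pos {T : ℝ} (hT : 0 < T) (μ : Measure X) :
    M.QM T μ = (uniformTime T).bind fun s => M.dual s μ := by
  rw [QM, if_neg hT.not_ge, uniformTime]

theorem isProbabilityMeasure_QM {T : ℝ} (hT : 0 < T) (μ : Measure X) [IsProbabilityMeasure μ] :
    IsProbabilityMeasure (M.QM T μ) := by
  have := isProbabilityMeasure_uniformTime hT
  rw [M.QM_of_pos hT]
  exact (integral_bind_of_bounded (M.measurable_dual μ) (M.isProbabilityMeasure_dual μ) (g := 0)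
    measurable_zero (C := 0) (by simp)).1

theorem isProbabilityMeasure_Q {T : ℝ} (hT : 0 < T) (x : X) : IsProbabilityMeasure (M.Q T x) :=
  M.isProbabilityMeasure_QM hT _

theorem integral_QM {T : ℝ} (hT : 0 < T) (μ : Measure X) [IsProbabilityMeasure μ] {g : X → ℝ}
    (hg : Measurable g) {C : ℝ} (hC : ∀ x, |g x| ≤ C) :
    ∫ x, g x ∂(M.QM T μ) = ∫ s, ∫ y, M.act s g y ∂μ ∂(uniformTime T) := by
  have := isProbabilityMeasure_uniformTime hT
  rw [M.QM_of_pos hT, (integral_bind_of_bounded (M.measurable_dual μ)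
    (M.isProbabilityMeasure_dual μ) hg hC).2]
  refine integral_congr_ae (Eventually.of_forall fun s => ?_)
  exact (integral_bind_of_bounded (M.measurable_P s) (M.prob s) hg hC).2

theorem integral_Q {T : ℝ} (hT : 0 < T) (x : X) {g : X → ℝ}
    (hg : Measurable g) {C : ℝ} (hC : ∀ x, |g x| ≤ C) :
    ∫ y, g y ∂(M.Q T x) = ∫ s, M.act s g x ∂(uniformTime T) := by
  rw [Q, M.integral_QM hT _ hg hC]
  refine integral_congr_ae (Eventually.of_forall fun s => ?_)
  exact integral_dirac' _ _ (M.measurable_act hg s).stronglyMeasurable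

theorem measurable_integral_Q {T : ℝ} (hT : 0 < T) {g : X → ℝ}
    (hg : Measurable g) {C : ℝ} (hC : ∀ x, |g x| ≤ C) :
    Measurable fun x => ∫ y, g y ∂(M.Q T x) := by
  have := isProbabilityMeasure_uniformTime hT
  simp_rw [fun x => M.integral_Q hT x hg hC]
  exact ((M.measurable_uncurry_act hg).stronglyMeasurable.integral_prod_left').measurable

theorem integral_integral_Q {T : ℝ} (hT : 0 < T) (μ : Measure X) [IsProbabilityMeasure μ]
    {g : X → ℝ} (hg : Measurable g) {C : ℝ} (hC : ∀ x, |g x| ≤ C) :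
    ∫ x, ∫ y, g y ∂(M.Q T x) ∂μ = ∫ s, ∫ y, M.act s g y ∂μ ∂(uniformTime T) := by
  have := isProbabilityMeasure_uniformTime hT
  simp_rw [fun x => M.integral_Q hT x hg hC]
  rw [integral_integral_swap]
  refine Integrable.of_bound
    ((M.measurable_uncurry_act hg).comp measurable_swap).aestronglyMeasurable C
    (Eventually.of_forall fun p => ?_)
  exact M.abs_act_le hC _ _

theorem abs_integral_Q_le {T : ℝ} (hT : 0 < T) {g : X → ℝ} {C : ℝ} (hC : ∀ x, |g x| ≤ C) (x : X) :
    |∫ y, g y ∂(M.Q T x)| ≤ C :=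
  have := M.isProbabilityMeasure_Q hT x
  abs_integral_le_of_abs_le _ (Eventually.of_forall hC)

theorem abs_integral_Q_act_sub_le {T t C : ℝ} (hT : 0 < T) (ht : 0 ≤ t) (x : X) {g : X → ℝ}
    (hg : Measurable g) (hC : ∀ x, |g x| ≤ C) :
    |∫ y, M.act t g y ∂(M.Q T x) - ∫ y, g y ∂(M.Q T x)| ≤ 2 * t * C / T := by
  have h1 : ∫ y, M.act t g y ∂(M.Q T x) = ∫ s, M.act (t + s) g x ∂(uniformTime T) := by
    rw [M.integral_Q hT x (M.measurable_act hg t) (M.abs_act_le hC t)]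
    refine integral_congr_ae ((ae_uniformTime_pos T).mono fun s hs => ?_)
    simp only [M.act_act hg hC hs.le ht, add_comm]
  rw [h1, M.integral_Q hT x hg hC]
  exact abs_integral_uniformTime_shift_sub_le hT ht (M.measurable_act_time hg x)
    fun s => M.abs_act_le hC s x

theorem abs_act_integral_Q_sub_le {T t C : ℝ} (hT : 0 < T) (ht : 0 ≤ t) (x : X) {g : X → ℝ}
    (hg : Measurable g) (hC : ∀ x, |g x| ≤ C) :
    |M.act t (fun y => ∫ w, g w ∂(M.Q T y)) x - ∫ y, g y ∂(M.Q T x)| ≤ 2 * t * C / T := by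
  have := M.prob t x
  have h1 : M.act t (fun y => ∫ w, g w ∂(M.Q T y)) x
      = ∫ s, M.act (t + s) g x ∂(uniformTime T) := by
    rw [act, M.integral_integral_Q hT _ hg hC]
    refine integral_congr_ae ((ae_uniformTime_pos T).mono fun s hs => ?_)
    exact M.act_act hg hC ht hs.le x
  rw [h1, M.integral_Q hT x hg hC]
  exact abs_integral_uniformTime_shift_sub_le hT ht (M.measurable_act_time hg x)
    fun s => M.abs_act_le hC s x

/-- If `P_t f (y) = f y`, then `P_t f² (y) - f(y)²` is the variance of `f` under `P_t(y, ·)`. -/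
theorem act_sq_sub_sq {f : X → ℝ} (hf : Measurable f) {C : ℝ} (hC : ∀ x, |f x| ≤ C) {t : ℝ}
    {y : X} (hinv : M.act t f y = f y) :
    M.act t (fun w => f w ^ 2) y - f y ^ 2 = ∫ w, (f w - f y) ^ 2 ∂(M.P t y) := by
  have := M.prob t y
  have hi := M.integrable_P hf hC t y
  have hi2 : Integrable (fun w => f w ^ 2) (M.P t y) :=
    M.integrable_P (hf.pow_const 2) (C := C ^ 2) (fun w => by
      rw [abs_pow]; exact pow_le_pow_left₀ (abs_nonneg _) (hC w) 2) t y
  have h1 : ∀ w, (f w - f y) ^ 2 = f w ^ 2 - 2 * f y * f w + f y ^ 2 := fun w => by ring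
  simp_rw [h1]
  rw [integral_add (f := fun w => f w ^ 2 - 2 * f y * f w) (hi2.sub (hi.const_mul _))
      (integrable_const _), integral_sub hi2 (hi.const_mul _), integral_const_mul]
  have h2 : ∫ w, f w ∂(M.P t y) = f y := hinv
  rw [h2]
  simp [act]
  ring

theorem integral_Q_eq_of_invariant {f : X → ℝ} (hf : Measurable f) {C : ℝ}
    (hC : ∀ x, |f x| ≤ C) (hinv : ∀ t, 0 ≤ t → ∀ y, M.act t f y = f y) {T : ℝ} (hT : 0 < T)
    (x : X) : ∫ y, f y ∂(M.Q T x) = f x := by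
  have := isProbabilityMeasure_uniformTime hT
  rw [M.integral_Q hT x hf hC, integral_congr_ae ((ae_uniformTime_pos T).mono fun s hs =>
    hinv s hs.le x)]
  simp

/-- If the time averages from `y` asymptotically charge `B`, then so does some transition
probability. -/
theorem exists_P_pos {B : Set X} (hB : MeasurableSet B) {y : X}
    (h : 0 < Filter.liminf (fun T : ℝ => ((M.Q T y) B).toReal) Filter.atTop) :
    ∃ t : ℝ, 0 ≤ t ∧ M.P t y B ≠ 0 := by
  by_contra! hcon
  have h0 : ∀ᶠ T : ℝ in atTop, ((M.Q T y) B).toReal = 0 := by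
    filter_upwards [eventually_gt_atTop 0] with T hT
    have h1 : M.Q T y B = 0 := by
      rw [Q, M.QM_of_pos hT, Measure.bind_apply hB (M.measurable_dual _).aemeasurable]
      refine (lintegral_congr_ae ((ae_uniformTime_pos T).mono fun s hs => ?_)).trans
        lintegral_zero
      rw [dual, Measure.dirac_bind (M.measurable_P s), hcon s hs.le]
    simp [h1]
  rw [liminf_congr h0] at h
  simp at h

section Topological

variable [TopologicalSpace X] [OpensMeasurableSpace X]

theorem exists_act_sq_sub_sq_pos {z : X}
    (hcharge : ∀ U : Set X, IsOpen U → z ∈ U → ∀ y, ∃ t : ℝ, 0 ≤ t ∧ M.P t y U ≠ 0)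
    {f : X → ℝ} (hf : Continuous f) {C : ℝ} (hC : ∀ x, |f x| ≤ C)
    (hinv : ∀ t, 0 ≤ t → ∀ y, M.act t f y = f y) {y : X} (hy : f y ≠ f z) :
    ∃ t, 0 ≤ t ∧ 0 < M.act t (fun w => f w ^ 2) y - f y ^ 2 := by
  have hU : IsOpen {w | f w ≠ f y} := isOpen_ne_fun hf continuous_const
  obtain ⟨t, ht, hpos⟩ := hcharge _ hU hy.symm y
  refine ⟨t, ht, ?_⟩
  have := M.prob t y
  rw [M.act_sq_sub_sq hf.measurable hC (hinv t ht y)]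
  refine lt_of_le_of_ne (integral_nonneg fun w => sq_nonneg _) fun h0 => hpos ?_
  have hint : Integrable (fun w => (f w - f y) ^ 2) (M.P t y) :=
    M.integrable_P (by have := hf.measurable; fun_prop) (C := (C + C) ^ 2) (fun w => by
      rw [abs_pow]
      exact pow_le_pow_left₀ (abs_nonneg _) ((abs_sub _ _).trans (add_le_add (hC w) (hC y))) 2) t y
  have hae := (integral_eq_zero_iff_of_nonneg (fun w => sq_nonneg _) hint).1 h0.symm
  have : ∀ᵐ w ∂(M.P t y), ¬ (f w ≠ f y) := hae.mono fun w hw => by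
    have : f w - f y = 0 := pow_eq_zero_iff (two_ne_zero) |>.1 hw
    simpa using sub_eq_zero.1 this
  simpa [ae_iff] using this

/-- A bounded continuous function invariant under a Feller semigroup all of whose trajectories
charge the neighbourhoods of `z` takes its value at `z` at every point with tight averages. -/
theorem invariant_eq_of_tightAt (hFeller : M.Feller) [T2Space X] {z : X}
    (hcharge : ∀ U : Set X, IsOpen U → z ∈ U → ∀ y, ∃ t : ℝ, 0 ≤ t ∧ M.P t y U ≠ 0)
    {f : X → ℝ} (hf : Continuous f) {C : ℝ} (hC : ∀ x, |f x| ≤ C)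
    (hinv : ∀ t, 0 ≤ t → ∀ y, M.act t f y = f y) {x : X} (hx : M.TightAt x) :
    f x = f z := by
  have hfm := hf.measurable
  have hC0 : 0 ≤ C := (abs_nonneg _).trans (hC x)
  have hf2 : ∀ w, |f w ^ 2| ≤ C ^ 2 := fun w => by
    rw [abs_pow]; exact pow_le_pow_left₀ (abs_nonneg _) (hC w) 2
  have hdiff : ∀ w, |f w - f z| ≤ 2 * C := fun w => by
    have := (abs_sub (f w) (f z)).trans (add_le_add (hC w) (hC z)); linarith
  have key : ∀ e : ℝ, 0 < e → |f x - f z| ≤ (2 + 2 * C) * e := by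
    intro e he
    obtain ⟨K, hK, hKT⟩ := hx e he
    obtain ⟨G, hGm, hG0, ⟨D, hD⟩, hGlim, hGK⟩ : ∃ G : X → ℝ, Measurable G ∧ (∀ w, 0 ≤ G w) ∧
        (∃ D, ∀ w, |G w| ≤ D) ∧
        Tendsto (fun T => ∫ w, G w ∂(M.Q T x)) atTop (𝓝 0) ∧
        ∀ w ∈ K, |f w - f z| ≤ e + G w := by
      refine hK.induction_on (p := fun s => ∃ G : X → ℝ, Measurable G ∧ (∀ w, 0 ≤ G w) ∧
        (∃ D, ∀ w, |G w| ≤ D) ∧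
        Tendsto (fun T => ∫ w, G w ∂(M.Q T x)) atTop (𝓝 0) ∧
        ∀ w ∈ s, |f w - f z| ≤ e + G w) ?_ ?_ ?_ ?_
      · exact ⟨0, measurable_zero, by simp, ⟨0, by simp⟩, by simp, by simp⟩
      · rintro s t hst ⟨G, h1, h2, h3, h4, h5⟩
        exact ⟨G, h1, h2, h3, h4, fun w hw => h5 w (hst hw)⟩
      · rintro s t ⟨G, h1, h2, ⟨D, h3⟩, h4, h5⟩ ⟨G', h1', h2', ⟨D', h3'⟩, h4', h5'⟩
        refine ⟨fun w => G w + G' w, h1.add h1', fun w => add_nonneg (h2 w) (h2' w),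
          ⟨D + D', fun w => (abs_add_le _ _).trans (add_le_add (h3 w) (h3' w))⟩, ?_, ?_⟩
        · have h6 := h4.add h4'
          rw [add_zero] at h6
          refine h6.congr' ?_
          filter_upwards [eventually_gt_atTop 0] with T hT
          have := M.isProbabilityMeasure_Q hT x
          rw [integral_add]
          · exact Integrable.of_bound h1.aestronglyMeasurable D (Eventually.of_forall h3)
          · exact Integrable.of_bound h1'.aestronglyMeasurable D' (Eventually.of_forall h3')
        · rintro w (hw | hw)
          · linarith [h5 w hw, h2' w]
          · linarith [h5' w hw, h2 w]
      · intro y _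
        by_cases hy : f y = f z
        · refine ⟨{w | |f w - f z| < e}, mem_nhdsWithin_of_mem_nhds ?_, 0, measurable_zero,
            by simp, ⟨0, by simp⟩, by simp, ?_⟩
          · refine IsOpen.mem_nhds (isOpen_lt (by fun_prop) continuous_const) ?_
            simpa [hy] using he
          · intro w hw
            simpa using (le_of_lt hw)
        · obtain ⟨t, ht, hpos⟩ := M.exists_act_sq_sub_sq_pos hcharge hf hC hinv hy
          set Φ : X → ℝ := fun w => M.act t (fun v => f v ^ 2) w - f w ^ 2 with hΦ
          have hΦc : Continuous Φ :=
            (hFeller t ht _ ⟨hf.pow 2, C ^ 2, hf2⟩).sub (hf.pow 2)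
          have hΦ0 : ∀ w, 0 ≤ Φ w := fun w => by
            rw [hΦ]
            simp only
            rw [M.act_sq_sub_sq hfm hC (hinv t ht w)]
            exact integral_nonneg fun v => sq_nonneg _
          have hΦb : ∀ w, |Φ w| ≤ C ^ 2 + C ^ 2 := fun w =>
            (abs_sub _ _).trans (add_le_add (M.abs_act_le hf2 t w) (hf2 w))
          set L : ℝ := (2 * C + 1) / Φ y with hL
          have hL0 : 0 < L := div_pos (by linarith) hpos
          refine ⟨{w | 2 * C < L * Φ w}, mem_nhdsWithin_of_mem_nhds ?_, fun w => L * Φ w,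
            (hΦc.const_mul L).measurable, fun w => mul_nonneg hL0.le (hΦ0 w),
            ⟨L * (C ^ 2 + C ^ 2), fun w => ?_⟩, ?_, ?_⟩
          · refine IsOpen.mem_nhds (isOpen_lt continuous_const (by fun_prop)) ?_
            have : L * Φ y = 2 * C + 1 := div_mul_cancel₀ _ hpos.ne'
            simp [this]
          · rw [abs_mul, abs_of_pos hL0]
            exact mul_le_mul_of_nonneg_left (hΦb w) hL0.le
          · have hz : Tendsto (fun T : ℝ => ∫ w, Φ w ∂(M.Q T x)) atTop (𝓝 0) := by
              refine squeeze_zero_norm' (a := fun T : ℝ => 2 * t * C ^ 2 / T) ?_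
                (tendsto_const_nhds.div_atTop tendsto_id)
              filter_upwards [eventually_gt_atTop 0] with T hT
              have := M.isProbabilityMeasure_Q hT x
              rw [hΦ, integral_sub]
              · exact M.abs_integral_Q_act_sub_le hT ht x (hfm.pow_const 2) hf2
              · exact Integrable.of_bound
                  (M.measurable_act (hfm.pow_const 2) t).aestronglyMeasurable _
                  (Eventually.of_forall (M.abs_act_le hf2 t))
              · exact Integrable.of_bound (hfm.pow_const 2).aestronglyMeasurable _
                  (Eventually.of_forall hf2)
            simpa [integral_const_mul] using hz.const_mul L
          · intro w hw
            have h1 : 2 * C < L * Φ w := hw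
            linarith [hdiff w]
    have hbound : ∀ᶠ T : ℝ in atTop,
        |f x - f z| ≤ e + (∫ w, G w ∂(M.Q T x)) + 2 * C * e := by
      filter_upwards [eventually_gt_atTop 0] with T hT
      have := M.isProbabilityMeasure_Q hT x
      have hKm := hK.measurableSet
      have hfi : Integrable f (M.Q T x) :=
        Integrable.of_bound hfm.aestronglyMeasurable C (Eventually.of_forall hC)
      have hGi : Integrable G (M.Q T x) :=
        Integrable.of_bound hGm.aestronglyMeasurable D (Eventually.of_forall hD)
      have hIi : Integrable (Kᶜ.indicator fun _ => 2 * C) (M.Q T x) :=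
        (integrable_const _).indicator hKm.compl
      have h1 : f x - f z = ∫ w, (f w - f z) ∂(M.Q T x) := by
        rw [integral_sub hfi (integrable_const _),
          M.integral_Q_eq_of_invariant hfm hC hinv hT]
        simp
      have hKc : (M.Q T x).real Kᶜ ≤ e := by
        rw [probReal_compl_eq_one_sub hKm]
        have := hKT T hT
        rw [← Measure.real] at this
        linarith
      calc |f x - f z| ≤ ∫ w, |f w - f z| ∂(M.Q T x) := by
            rw [h1]; exact abs_integral_le_integral_abs
        _ ≤ ∫ w, (e + G w + Kᶜ.indicator (fun _ => 2 * C) w) ∂(M.Q T x) := by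
            refine integral_mono (hfi.sub (integrable_const _)).abs
              (((integrable_const _).add hGi).add hIi) fun w => ?_
            by_cases hw : w ∈ K
            · simpa [hw] using hGK w hw
            · simp only [Set.indicator, Set.mem_compl_iff, hw, not_false_eq_true, if_true]
              linarith [hdiff w, hG0 w]
        _ = e + (∫ w, G w ∂(M.Q T x)) + 2 * C * (M.Q T x).real Kᶜ := by
            rw [integral_add (f := fun w => e + G w) ((integrable_const _).add hGi) hIi,
              integral_add (integrable_const _) hGi, integral_indicator hKm.compl]
            simp [mul_comm]
        _ ≤ _ := by gcongr
    have hlim : Tendsto (fun T => e + (∫ w, G w ∂(M.Q T x)) + 2 * C * e) atTop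
        (𝓝 (e + 0 + 2 * C * e)) := (tendsto_const_nhds.add hGlim).add tendsto_const_nhds
    have := ge_of_tendsto hlim hbound
    linarith
  have hle : |f x - f z| ≤ 0 := by
    refine le_of_forall_pos_le_add fun e he => ?_
    have h2 : 0 < 2 + 2 * C := by linarith
    have := key (e / (2 + 2 * C)) (by positivity)
    rwa [mul_div_cancel₀ _ h2.ne', ← zero_add e] at this
  exact sub_eq_zero.1 (abs_nonpos_iff.1 hle)

end Topological

section Metric

variable {X : Type*} [MetricSpace X] [MeasurableSpace X] [BorelSpace X] {M : MarkovSemigroup X}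

/-- The e-property passes to time averages. -/
theorem EProperty.equicontinuous_integral_Q (hE : M.EProperty) {ψ : X → ℝ}
    (hψ : IsBddLipschitz ψ) {S : ℕ → ℝ} (hS : ∀ n, 0 < S n) :
    Equicontinuous fun n x => ∫ y, ψ y ∂(M.Q (S n) x) := by
  obtain ⟨⟨L, hL⟩, C, hC⟩ := id hψ
  have hm := hL.continuous.measurable
  intro x
  rw [Metric.equicontinuousAt_iff]
  intro e he
  obtain ⟨δ, hδ, h⟩ := hE ψ hψ x (e / 2) (half_pos he)
  refine ⟨δ, hδ, fun y hy n => ?_⟩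
  have := isProbabilityMeasure_uniformTime (hS n)
  have hi : ∀ w, Integrable (fun s => M.act s ψ w) (uniformTime (S n)) := fun w =>
    Integrable.of_bound (M.measurable_act_time hm w).aestronglyMeasurable C
      (Eventually.of_forall fun s => M.abs_act_le hC s w)
  rw [dist_comm, Real.dist_eq]
  rw [M.integral_Q (hS n) _ hm hC, M.integral_Q (hS n) _ hm hC, ← integral_sub (hi y) (hi x)]
  refine (abs_integral_le_of_abs_le _ (C := e / 2) ?_).trans_lt (half_lt_self he)
  exact (ae_uniformTime_pos _).mono fun s hs => (h y hy s hs.le).le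

/-- Time averages started from probability measures built from tight points merge. -/
theorem tendsto_integral_QM_sub [SecondCountableTopology X]
    (hFeller : M.Feller) (hE : M.EProperty) {z : X}
    (hlow : ∀ δ : ℝ, 0 < δ → ∀ x : X,
      0 < Filter.liminf (fun T : ℝ => ((M.Q T x) (Metric.ball z δ)).toReal) Filter.atTop)
    {ψ : X → ℝ} (hψ : IsBddLipschitz ψ) {x₁ x₂ : X} (hx₁ : M.TightAt x₁) (hx₂ : M.TightAt x₂)
    {T : ℝ} (hT : 0 < T) :
    Tendsto (fun S : ℝ => (∫ y, ψ y ∂(M.QM S (M.Q T x₁))) - ∫ y, ψ y ∂(M.QM S (M.Q T x₂)))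
      atTop (𝓝 0) := by
  obtain ⟨⟨L, hL⟩, C, hC⟩ := id hψ
  have hm := hL.continuous.measurable
  have hcharge : ∀ U : Set X, IsOpen U → z ∈ U → ∀ y, ∃ t : ℝ, 0 ≤ t ∧ M.P t y U ≠ 0 := by
    intro U hU hz y
    obtain ⟨δ, hδ, hsub⟩ := Metric.isOpen_iff.1 hU z hz
    obtain ⟨t, ht, hpos⟩ := M.exists_P_pos measurableSet_ball (hlow δ hδ y)
    exact ⟨t, ht, fun h0 => hpos (measure_mono_null hsub h0)⟩
  refine tendsto_of_subseq_tendsto fun R hR => ?_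
  obtain ⟨N, hN⟩ := (eventually_atTop.1 (hR.eventually_gt_atTop 0))
  have hS0 : ∀ n, 0 < R (n + N) := fun n => hN _ (by omega)
  obtain ⟨f, hfc, φ, hφ, hlim⟩ :=
    (hE.equicontinuous_integral_Q hψ hS0).exists_subseq_tendsto
      (fun n x => M.abs_integral_Q_le (hS0 n) hC x)
  have hS0' : ∀ n, 0 < R (φ n + N) := fun n => hS0 _
  have hSlim : Tendsto (fun n => R (φ n + N)) atTop atTop :=
    hR.comp ((tendsto_add_atTop_nat N).comp hφ.tendsto_atTop)
  have hfC : ∀ x, |f x| ≤ C := fun x =>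
    le_of_tendsto (hlim x).abs (Eventually.of_forall fun n => M.abs_integral_Q_le (hS0' n) hC x)
  have hdom : ∀ μ : Measure X, IsProbabilityMeasure μ →
      Tendsto (fun n => ∫ x, ∫ y, ψ y ∂(M.Q (R (φ n + N)) x) ∂μ) atTop (𝓝 (∫ x, f x ∂μ)) := by
    intro μ hμ
    refine tendsto_integral_of_dominated_convergence (fun _ => C)
      (fun n => (M.measurable_integral_Q (hS0' n) hm hC).aestronglyMeasurable)
      (integrable_const _)
      (fun n => Eventually.of_forall fun x => M.abs_integral_Q_le (hS0' n) hC x)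
      (Eventually.of_forall hlim)
  have hinv : ∀ t, 0 ≤ t → ∀ y, M.act t f y = f y := by
    intro t ht y
    have h1 := (hdom (M.P t y) (M.prob t y)).sub (hlim y)
    have h2 : Tendsto (fun n => 2 * t * C / R (φ n + N)) atTop (𝓝 0) :=
      tendsto_const_nhds.div_atTop hSlim
    have h3 := squeeze_zero_norm (f := fun n =>
      M.act t (fun w => ∫ v, ψ v ∂(M.Q (R (φ n + N)) w)) y - ∫ v, ψ v ∂(M.Q (R (φ n + N)) y))
      (fun n => M.abs_act_integral_Q_sub_le (hS0' n) ht y hm hC) h2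
    exact sub_eq_zero.1 (tendsto_nhds_unique h1 h3)
  refine ⟨fun n => φ n + N, ?_⟩
  have hp₁ := M.isProbabilityMeasure_Q hT x₁
  have hp₂ := M.isProbabilityMeasure_Q hT x₂
  have h1 := (hdom _ hp₁).sub (hdom _ hp₂)
  rw [M.integral_Q_eq_of_invariant hfc.measurable hfC hinv hT,
    M.integral_Q_eq_of_invariant hfc.measurable hfC hinv hT,
    M.invariant_eq_of_tightAt hFeller hcharge hfc hfC hinv hx₁,
    M.invariant_eq_of_tightAt hFeller hcharge hfc hfC hinv hx₂, sub_self] at h1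
  refine h1.congr fun n => ?_
  rw [M.integral_integral_Q (hS0' n) _ hm hC, M.integral_integral_Q (hS0' n) _ hm hC,
    M.integral_QM (hS0' n) _ hm hC, M.integral_QM (hS0' n) _ hm hC]

end Metric

end MarkovSemigroup

/-- Lemma 3 of the paper. Under the standing assumptions, the set `Δ`
of positive `α` for which one can approximate the ergodic averages from `x₁, x₂ ∈ 𝒯`
in total variation by measures having a common component of mass `α` with asymptotically
`ε`-close ergodic averages, is nonempty and `sup Δ = 1`. -/
theorem delta_nonempty_and_sup_eq_one
    {X : Type*} [MetricSpace X] [CompleteSpace X] [SecondCountableTopology X]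
    [MeasurableSpace X] [BorelSpace X]
    (M : MarkovSemigroup X)
    (hFeller : M.Feller) (hSC : M.StochasticallyContinuous) (hE : M.EProperty)
    (z : X)
    (hlow : ∀ δ : ℝ, 0 < δ → ∀ x : X,
      0 < Filter.liminf (fun T : ℝ => ((M.Q T x) (Metric.ball z δ)).toReal)
        Filter.atTop)
    (ε : ℝ) (hε : 0 < ε)
    (η : ℕ → ℝ) (hηpos : ∀ n, 0 < η n) (hηanti : Antitone η)
    (hηlim : Filter.Tendsto η Filter.atTop (nhds 0))
    (x₁ x₂ : X) (hx₁ : M.TightAt x₁) (hx₂ : M.TightAt x₂)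
    (ψ : X → ℝ) (hψ : IsBddLipschitz ψ)
    (Δ : Set ℝ)
    (hΔ : Δ = {α : ℝ | 0 < α ∧ ∃ N : ℕ, 0 < N ∧ ∃ T : ℕ → ℝ,
      ∃ μ₁ μ₂ ν₁ ν₂ : ℕ → MeasureTheory.Measure X,
      ∀ n : ℕ, N ≤ n →
        ((n : ℝ) ≤ T n ∧
         MeasureTheory.IsProbabilityMeasure (μ₁ n) ∧
         MeasureTheory.IsProbabilityMeasure (μ₂ n) ∧
         MeasureTheory.IsProbabilityMeasure (ν₁ n) ∧
         MeasureTheory.IsProbabilityMeasure (ν₂ n) ∧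
         tvDist (M.Q (T n) x₁) (μ₁ n) < η n ∧
         tvDist (M.Q (T n) x₂) (μ₂ n) < η n ∧
         (∀ B : Set X, MeasurableSet B →
           ENNReal.ofReal α * (ν₁ n) B ≤ (μ₁ n) B) ∧
         (∀ B : Set X, MeasurableSet B →
           ENNReal.ofReal α * (ν₂ n) B ≤ (μ₂ n) B) ∧
         Filter.limsup
           (fun S : ℝ =>
             |(∫ y, ψ y ∂(M.QM S (ν₁ n))) - (∫ y, ψ y ∂(M.QM S (ν₂ n)))|)
           Filter.atTop < ε)}) :
    Δ.Nonempty ∧ sSup Δ = 1 := by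
  have hone : (1 : ℝ) ∈ Δ := by
    rw [hΔ]
    refine ⟨one_pos, 1, one_pos, fun n => n, fun n => M.Q n x₁, fun n => M.Q n x₂,
      fun n => M.Q n x₁, fun n => M.Q n x₂, fun n hn => ?_⟩
    have hn0 : (0 : ℝ) < n := by exact_mod_cast hn
    have htv : ∀ μ : Measure X, tvDist μ μ = 0 := fun μ => by simp [tvDist]
    refine ⟨le_rfl, M.isProbabilityMeasure_Q hn0 x₁, M.isProbabilityMeasure_Q hn0 x₂,
      M.isProbabilityMeasure_Q hn0 x₁, M.isProbabilityMeasure_Q hn0 x₂,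
      by rw [htv]; exact hηpos n, by rw [htv]; exact hηpos n, by simp, by simp, ?_⟩
    have hlim := (MarkovSemigroup.tendsto_integral_QM_sub hFeller hE hlow hψ hx₁ hx₂ hn0).abs
    rw [hlim.limsup_eq, abs_zero]
    exact hε
  have hub : ∀ α ∈ Δ, α ≤ 1 := by
    intro α hα
    rw [hΔ] at hα
    obtain ⟨-, N, -, T, μ₁, μ₂, ν₁, ν₂, h⟩ := hα
    obtain ⟨-, hμ, -, hν, -, -, -, hle, -⟩ := h N le_rfl
    simpa using hle Set.univ MeasurableSet.univ
  exact ⟨⟨1, hone⟩, IsGreatest.csSup_eq ⟨hone, hub⟩⟩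
end
end

section
/- Let (P_t)_{t≥0} be a Markov transition semigroup on a Polish metric space 𝒳 with the e-property which is weak-* mean ergodic with invariant limit measure μ*. Let ψ be a bounded Lipschitz function and for t > 0 put Ψ_t(x) := (1/t)∫₀^t P_s ψ(x) ds. Then for every ε > 0 and every compact set K ⊆ 𝒳 there exists t₀ > 0 such that sup_{x∈K} | Ψ_t(x) − ∫ ψ dμ* | < ε for all t ≥ t₀. -/
open MeasureTheory Filter Topology Metric Set

noncomputable section

/-- `Ψ_t(x) = (1/t) ∫_0^t P_s ψ(x) ds` for `t > 0`. -/
def MarkovSemigroup.Psi {X : Type*} [MeasurableSpace X] (M : MarkovSemigroup X)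
    (ψ : X → ℝ) (t : ℝ) (x : X) : ℝ :=
  if t ≤ 0 then ψ x else (1 / t) * ∫ s in Set.Ioc (0 : ℝ) t, M.act s ψ x

namespace MarkovSemigroup

section TimeAverages

open scoped ProbabilityTheory

variable {X : Type*} [MeasurableSpace X] (M : MarkovSemigroup X)

/-- The law at time `s` started from `x`, as a kernel in the time variable `s`. -/
def timeKernel (x : X) : ProbabilityTheory.Kernel ℝ X where
  toFun s := M.P s x
  measurable' := M.meas.comp (measurable_id.prodMk measurable_const)

instance (x : X) : ProbabilityTheory.IsMarkovKernel (M.timeKernel x) :=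
  ⟨fun s => M.prob s x⟩

theorem dual_dirac (s : ℝ) (x : X) : M.dual s (Measure.dirac x) = M.P s x :=
  Measure.dirac_bind (M.meas.comp (measurable_const.prodMk measurable_id)) x

theorem QM_dirac {T : ℝ} (hT : 0 < T) (x : X) :
    M.QM T (Measure.dirac x) =
      (ENNReal.ofReal (1 / T) • volume.restrict (Ioc (0 : ℝ) T)).bind (M.timeKernel x) := by
  rw [QM, if_neg hT.not_ge]
  simp only [dual_dirac]
  rfl

variable {f : X → ℝ} {C : ℝ}

theorem abs_act_le_s13 (hf : ∀ x, |f x| ≤ C) (s : ℝ) (x : X) : |M.act s f x| ≤ C := by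
  have := M.prob s x
  simpa [act] using
    norm_integral_le_of_norm_le_const (μ := M.P s x) (f := f) (Eventually.of_forall hf)

theorem integrableOn_act (hfm : StronglyMeasurable f) (hf : ∀ x, |f x| ≤ C) (T : ℝ) (x : X) :
    IntegrableOn (fun s => M.act s f x) (Ioc (0 : ℝ) T) :=
  .of_bound measure_Ioc_lt_top
    (hfm.integral_kernel (κ := M.timeKernel x)).aestronglyMeasurable C
    (Eventually.of_forall fun s => M.abs_act_le_s13 hf s x)

/-- The duality relation `∫ f dQ^T δ_x = Ψ_T(x)`. -/
theorem integral_QM_dirac (hfm : StronglyMeasurable f) (hf : ∀ x, |f x| ≤ C) {T : ℝ}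
    (hT : 0 < T) (x : X) :
    ∫ y, f y ∂(M.QM T (Measure.dirac x)) = M.Psi f T x := by
  rw [M.QM_dirac hT, Psi, if_neg hT.not_ge]
  set m : Measure ℝ := ENNReal.ofReal (1 / T) • volume.restrict (Ioc (0 : ℝ) T) with hm
  have hm_finite : IsFiniteMeasure m := Measure.smul_finite _ ENNReal.ofReal_ne_top
  have hint : Integrable f
      ((M.timeKernel x ∘ₖ ProbabilityTheory.Kernel.const Unit m) ()) :=
    .of_bound hfm.aestronglyMeasurable C (Eventually.of_forall hf)
  have hcomp := ProbabilityTheory.Kernel.integral_comp hint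
  rw [ProbabilityTheory.Kernel.comp_apply, ProbabilityTheory.Kernel.const_apply] at hcomp
  rw [hcomp, hm, integral_smul_measure, ENNReal.toReal_ofReal (by positivity), smul_eq_mul]
  rfl

theorem abs_Psi_sub_le (hfm : StronglyMeasurable f) (hf : ∀ x, |f x| ≤ C) {T ε : ℝ}
    (hT : 0 < T) {x z : X} (h : ∀ s, 0 ≤ s → |M.act s f z - M.act s f x| ≤ ε) :
    |M.Psi f T z - M.Psi f T x| ≤ ε := by
  rw [Psi, Psi, if_neg hT.not_ge, if_neg hT.not_ge, ← mul_sub,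
    ← integral_sub (M.integrableOn_act hfm hf T z) (M.integrableOn_act hfm hf T x),
    abs_mul, abs_of_pos (by positivity)]
  have hle := norm_setIntegral_le_of_norm_le_const (μ := volume) (s := Ioc (0 : ℝ) T)
    (f := fun s => M.act s f z - M.act s f x) measure_Ioc_lt_top fun s hs => h s hs.1.le
  rw [Real.volume_real_Ioc_of_le hT.le, sub_zero, Real.norm_eq_abs] at hle
  rwa [one_div, inv_mul_le_iff₀ hT, mul_comm]

end TimeAverages

end MarkovSemigroup

/-- Lemma 6 of the paper. For a Markov semigroup with the e-property
which is weak-* mean ergodic with limit `μ*`, the time averages `Ψ_t` of a bounded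
Lipschitz observable converge to `∫ ψ dμ*` uniformly on compact sets. -/
theorem Psi_tendsto_uniformly_on_compacts
    {X : Type*} [MetricSpace X] [CompleteSpace X] [SecondCountableTopology X]
    [MeasurableSpace X] [BorelSpace X]
    (M : MarkovSemigroup X) (hE : M.EProperty)
    (μstar : MeasureTheory.Measure X)
    (hprob : MeasureTheory.IsProbabilityMeasure μstar)
    (hinv : M.Invariant μstar)
    (hErg : M.WeakStarMeanErgodic μstar)
    (ψ : X → ℝ) (hψ : IsBddLipschitz ψ) :
    ∀ ε : ℝ, 0 < ε → ∀ K : Set X, IsCompact K →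
      ∃ t₀ : ℝ, 0 < t₀ ∧ ∀ t : ℝ, t₀ ≤ t → ∀ x ∈ K,
        |M.Psi ψ t x - ∫ y, ψ y ∂μstar| < ε := by
  obtain ⟨⟨L, hL⟩, C, hC⟩ := id hψ
  have hψm : StronglyMeasurable ψ := hL.continuous.stronglyMeasurable
  intro ε hε K hK
  suffices h : ∀ᶠ t in atTop, ∀ x ∈ K, |M.Psi ψ t x - ∫ y, ψ y ∂μstar| < ε by
    obtain ⟨t₀, ht₀⟩ := eventually_atTop.1 h
    exact ⟨max t₀ 1, by positivity, fun t ht => ht₀ t (le_of_max_le_left ht)⟩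
  refine hK.induction_on
    (p := fun S => ∀ᶠ t in atTop, ∀ x ∈ S, |M.Psi ψ t x - ∫ y, ψ y ∂μstar| < ε)
    (by simp) (fun S S' hS h => h.mono fun t ht x hx => ht x (hS hx))
    (fun S S' h h' => (h.and h').mono fun t ht x hx => hx.elim (ht.1 x) (ht.2 x)) ?_
  intro x _
  obtain ⟨δ, hδ, hball⟩ := hE ψ hψ x (ε / 2) (half_pos hε)
  refine ⟨ball x δ, mem_nhdsWithin_of_mem_nhds (ball_mem_nhds x hδ), ?_⟩
  have hlim := hErg (Measure.dirac x) inferInstance ψ ⟨hL.continuous, C, hC⟩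
  filter_upwards [eventually_gt_atTop 0, hlim.eventually (ball_mem_nhds _ (half_pos hε))]
    with t ht hdist z hz
  rw [M.integral_QM_dirac hψm hC ht, Real.dist_eq] at hdist
  have hosc := M.abs_Psi_sub_le hψm hC ht fun s hs => (hball z hz s hs).le
  linarith [abs_sub_le (M.Psi ψ t z) (M.Psi ψ t x) (∫ y, ψ y ∂μstar)]
end
end
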